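/- arXiv:1911.00972 — 6 statements merged into one kernel-verified Lean document; each statement's English description precedes it below -/
import Mathlib

section
/- Let k ≥ 1 and n be integers with n − 1 ≥ k. Define f(a) = (a_1! · a_2! ⋯ a_k!) · √(a_1 · a_2 ⋯ a_k) for a composition a of n−1 into k positive parts. If b is a composition of n−1 into k positive parts that is balanced, i.e., |b_i − b_j| ≤ 1 for all 1 ≤ i, j ≤ k, then for every composition a of n−1 into k positive parts, f(b) ≤ f(a). -/
/-- A sequence that is convex on the positive integers lies above each of its secant lines through
consecutive points. -/
lemma secant_le_of_convex_seq {f : ℕ → ℝ}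
    (hf : ∀ m, 1 ≤ m → f (m + 1) - f m ≤ f (m + 2) - f (m + 1))
    {c m : ℕ} (hc : 1 ≤ c) (hm : 1 ≤ m) :
    f c + ((m : ℝ) - c) * (f (c + 1) - f c) ≤ f m := by
  have hmono : ∀ p q, 1 ≤ p → p ≤ q → f (p + 1) - f p ≤ f (q + 1) - f q := by
    intro p q hp hpq
    induction q, hpq using Nat.le_induction with
    | base => exact le_rfl
    | succ q hpq ih => exact ih.trans (hf q (hp.trans hpq))
  rcases le_total c m with h | h
  · induction m, h using Nat.le_induction with
    | base => simp
    | succ m hcm ih =>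
      have := ih (hc.trans hcm)
      have := hmono c m hc hcm
      push_cast
      linarith
  · induction h using Nat.decreasingInduction with
    | self => simp
    | of_succ m hmc ih =>
      have := ih (by omega)
      have := hmono m c hm hmc.le
      push_cast at *
      linarith

/-- Balanced tuples of positive integers minimize the sum of a convex sequence among all tuples of
positive integers with the same total. -/
lemma sum_le_sum_of_convex_seq_of_balanced {ι : Type*} [Fintype ι] {f : ℕ → ℝ}
    (hf : ∀ m, 1 ≤ m → f (m + 1) - f m ≤ f (m + 2) - f (m + 1))
    {a b : ι → ℕ} (ha : ∀ i, 1 ≤ a i) (hb : ∀ i, 1 ≤ b i)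
    (hbal : ∀ i j, b i ≤ b j + 1) (hsum : ∑ i, b i = ∑ i, a i) :
    ∑ i, f (b i) ≤ ∑ i, f (a i) := by
  cases isEmpty_or_nonempty ι
  · simp
  obtain ⟨i₀, hmin⟩ := Finite.exists_min b
  have hfb : ∀ i, f (b i) = f (b i₀) + ((b i : ℝ) - b i₀) * (f (b i₀ + 1) - f (b i₀)) := by
    intro i
    have hle := hbal i i₀
    have hge := hmin i
    obtain h | h : b i = b i₀ ∨ b i = b i₀ + 1 := by omega
    · simp [h]
    · simp [h]
  have hsum' : ∑ i, (b i : ℝ) = ∑ i, (a i : ℝ) := mod_cast hsum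
  calc ∑ i, f (b i)
      = ∑ i, (f (b i₀) + ((b i : ℝ) - b i₀) * (f (b i₀ + 1) - f (b i₀))) :=
        Finset.sum_congr rfl fun i _ => hfb i
    _ = ∑ i, (f (b i₀) + ((a i : ℝ) - b i₀) * (f (b i₀ + 1) - f (b i₀))) := by
        simp only [Finset.sum_add_distrib, ← Finset.sum_mul, Finset.sum_sub_distrib, hsum']
    _ ≤ ∑ i, f (a i) := Finset.sum_le_sum fun i _ => secant_le_of_convex_seq hf (hb i₀) (ha i)

/-- The sequence `m ↦ m! * √m` is log-convex on the positive integers. -/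
lemma log_factorial_mul_sqrt_convex (m : ℕ) (hm : 1 ≤ m) :
    Real.log ((m + 1).factorial * √((m + 1 : ℕ) : ℝ)) - Real.log (m.factorial * √(m : ℝ)) ≤
      Real.log ((m + 2).factorial * √((m + 2 : ℕ) : ℝ)) -
        Real.log ((m + 1).factorial * √((m + 1 : ℕ) : ℝ)) := by
  have hm' : (1 : ℝ) ≤ m := mod_cast hm
  have hlog : ∀ p : ℕ, 1 ≤ p → Real.log (p.factorial * √(p : ℝ)) =
      Real.log p.factorial + Real.log p / 2 := by
    intro p hp
    have : (0 : ℝ) < p := mod_cast hp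
    rw [Real.log_mul (by positivity) (by positivity), Real.log_sqrt this.le]
  have hfac : ∀ p : ℕ, Real.log (p + 1).factorial =
      Real.log ((p + 1 : ℕ) : ℝ) + Real.log p.factorial := by
    intro p
    rw [Nat.factorial_succ, Nat.cast_mul, Real.log_mul (by positivity) (by positivity)]
  have key : 4 * Real.log ((m + 1 : ℕ) : ℝ) ≤ 3 * Real.log ((m + 2 : ℕ) : ℝ) + Real.log m := by
    have h : ((m + 1 : ℕ) : ℝ) ^ 4 ≤ ((m + 2 : ℕ) : ℝ) ^ 3 * m := by
      push_cast
      nlinarith [pow_pos (zero_lt_one.trans_le hm') 3, sq_nonneg (m : ℝ)]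
    have := Real.log_le_log (by positivity) h
    rw [Real.log_mul (by positivity) (by positivity), Real.log_pow, Real.log_pow] at this
    exact_mod_cast this
  rw [hlog _ hm, hlog (m + 1) (by omega), hlog (m + 2) (by omega), hfac (m + 1), hfac m]
  linarith


/-- Lemma 2, part 1: among compositions of `n - 1` into `k` positive parts, the quantity
`(∏ i, (a i)!) * √(∏ i, a i)` is minimized at any balanced composition `b`
(one with `|b i - b j| ≤ 1` for all `i, j`). -/
theorem countSketch_factorial_sqrt_min_at_balanced
    (k n : ℕ) (hk : 1 ≤ k) (hn : k ≤ n - 1)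
    (b : Fin k → ℕ) (hbpos : ∀ i, 1 ≤ b i) (hbsum : ∑ i, b i = n - 1)
    (hbal : ∀ i j, |(b i : ℤ) - (b j : ℤ)| ≤ 1)
    (a : Fin k → ℕ) (hapos : ∀ i, 1 ≤ a i) (hasum : ∑ i, a i = n - 1) :
    ((∏ i, Nat.factorial (b i) : ℕ) : ℝ) * Real.sqrt (∏ i, (b i : ℝ)) ≤
    ((∏ i, Nat.factorial (a i) : ℕ) : ℝ) * Real.sqrt (∏ i, (a i : ℝ)) := by
  have hprod : ∀ c : Fin k → ℕ, ((∏ i, Nat.factorial (c i) : ℕ) : ℝ) * √(∏ i, (c i : ℝ)) =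
      ∏ i, ((c i).factorial * √(c i : ℝ)) := by
    intro c
    rw [Finset.prod_mul_distrib, Nat.cast_prod, Real.sqrt_prod _ fun i _ => Nat.cast_nonneg _]
  have hpos : ∀ c : Fin k → ℕ, (∀ i, 1 ≤ c i) → ∀ i, 0 < (c i).factorial * √(c i : ℝ) := by
    intro c hc i
    have : (0 : ℝ) < c i := mod_cast hc i
    positivity
  rw [hprod, hprod]
  refine (Real.log_le_log_iff (Finset.prod_pos fun i _ => hpos b hbpos i)
    (Finset.prod_pos fun i _ => hpos a hapos i)).mp ?_
  rw [Real.log_prod fun i _ => (hpos b hbpos i).ne', Real.log_prod fun i _ => (hpos a hapos i).ne']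
  refine sum_le_sum_of_convex_seq_of_balanced (f := fun m => Real.log (m.factorial * √(m : ℝ)))
    log_factorial_mul_sqrt_convex hapos hbpos (fun i j => ?_) (hbsum.trans hasum.symm)
  have := (abs_le.mp (hbal i j)).2
  omega
end

section
/- Let k ≥ 1 and n be integers with n − 1 ≥ k. If b is a composition of n−1 into k positive parts that is balanced, i.e., |b_i − b_j| ≤ 1 for all 1 ≤ i, j ≤ k, then for every composition a of n−1 into k positive parts, 1/b_1 + 1/b_2 + ⋯ + 1/b_k ≤ 1/a_1 + 1/a_2 + ⋯ + 1/a_k. -/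
/-- The secant line of `x ↦ 1 / x` through the consecutive integers `m` and `m + 1` lies below
the function at every positive integer. -/
theorem secant_le_one_div {m x : ℕ} (hm : 1 ≤ m) (hx : 1 ≤ x) :
    (2 * m + 1 - x : ℝ) / (m * (m + 1)) ≤ 1 / x := by
  have hm' : (0 : ℝ) < m := by exact_mod_cast hm
  have hx' : (0 : ℝ) < x := by exact_mod_cast hx
  have key : (0 : ℝ) ≤ (x - m) * (x - (m + 1)) := by
    rcases le_or_gt x m with h | h
    · have h' : (x : ℝ) ≤ m := by exact_mod_cast h
      exact mul_nonneg_of_nonpos_of_nonpos (by linarith) (by linarith)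
    · have h' : (m : ℝ) + 1 ≤ x := by exact_mod_cast h
      exact mul_nonneg (by linarith) (by linarith)
  rw [div_le_div_iff₀ (by positivity) hx']
  linarith

/-- The secant line of `x ↦ 1 / x` through `m` and `m + 1` agrees with the function there. -/
theorem one_div_eq_secant {m x : ℕ} (hm : 1 ≤ m) (hx : x = m ∨ x = m + 1) :
    (1 : ℝ) / x = (2 * m + 1 - x) / (m * (m + 1)) := by
  have hm' : (0 : ℝ) < m := by exact_mod_cast hm
  rcases hx with rfl | rfl
  · field_simp
    ring
  · push_cast
    field_simp
    ring

/-- Lemma 2, part 2: among compositions of `n - 1` into `k` positive parts, the sum of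
reciprocals `∑ i, 1 / a i` is minimized at any balanced composition `b`
(one with `|b i - b j| ≤ 1` for all `i, j`). -/
theorem countSketch_reciprocal_sum_min_at_balanced
    (k n : ℕ) (hk : 1 ≤ k) (hn : k ≤ n - 1)
    (b : Fin k → ℕ) (hbpos : ∀ i, 1 ≤ b i) (hbsum : ∑ i, b i = n - 1)
    (hbal : ∀ i j, |(b i : ℤ) - (b j : ℤ)| ≤ 1)
    (a : Fin k → ℕ) (hapos : ∀ i, 1 ≤ a i) (hasum : ∑ i, a i = n - 1) :
    ∑ i, (1 : ℝ) / (b i : ℝ) ≤ ∑ i, (1 : ℝ) / (a i : ℝ) := by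
  have : Nonempty (Fin k) := ⟨⟨0, hk⟩⟩
  obtain ⟨j, hj⟩ := Finite.exists_min b
  have hb (i : Fin k) : b i = b j ∨ b i = b j + 1 := by
    have h := abs_le.mp (hbal i j)
    have h' := hj i
    omega
  have hsum : ∑ i, (b i : ℝ) = ∑ i, (a i : ℝ) := by
    exact_mod_cast hbsum.trans hasum.symm
  calc ∑ i, (1 : ℝ) / (b i : ℝ)
      = ∑ i, (2 * b j + 1 - b i : ℝ) / (b j * (b j + 1)) :=
        Finset.sum_congr rfl fun i _ => one_div_eq_secant (hbpos j) (hb i)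
    _ = ∑ i, (2 * b j + 1 - a i : ℝ) / (b j * (b j + 1)) := by
        simp only [← Finset.sum_div, Finset.sum_sub_distrib, hsum]
    _ ≤ ∑ i, (1 : ℝ) / (a i : ℝ) :=
        Finset.sum_le_sum fun i _ => secant_le_one_div (hbpos j) (hapos i)
end

section
/- Let a_1, …, a_k be positive integers and let i ≠ j be indices with a_j ≥ a_i + 2. Let a' be the tuple obtained from (a_1, …, a_k) by replacing a_i with a_i + 1 and a_j with a_j − 1. Then (a'_1! ⋯ a'_k!) · √(a'_1 ⋯ a'_k) < (a_1! ⋯ a_k!) · √(a_1 ⋯ a_k); i.e., moving one unit from a larger part (exceeding a smaller part by at least 2) to the smaller part strictly decreases the quantity f(a) = (∏_i a_i!) · √(∏_i a_i). -/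
theorem Nat.succ_pow_three_mul_lt {x z : ℕ} (hx : 1 ≤ x) (hxz : x < z) :
    (x + 1) ^ 3 * z < (z + 1) ^ 3 * x := by
  obtain ⟨x, rfl⟩ := Nat.exists_eq_add_of_le hx
  obtain ⟨d, rfl⟩ := Nat.exists_eq_add_of_lt hxz
  ring_nf
  nlinarith [Nat.zero_le (x * d), Nat.zero_le (x ^ 2 * d), Nat.zero_le (x * d ^ 2),
    Nat.zero_le (x ^ 2 * d ^ 2), Nat.zero_le (x ^ 3 * d), Nat.zero_le (x * d ^ 3),
    Nat.zero_le (d ^ 3), Nat.zero_le (d ^ 2), Nat.zero_le (x ^ 3), Nat.zero_le (x ^ 2),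
    Nat.zero_le (x ^ 4)]

theorem Real.factorial_mul_sqrt_balance_lt {x z : ℕ} (hx : 1 ≤ x) (hxz : x < z) :
    ((x + 1).factorial * √((x + 1 : ℕ) : ℝ)) * (z.factorial * √(z : ℝ)) <
      (x.factorial * √(x : ℝ)) * ((z + 1).factorial * √((z + 1 : ℕ) : ℝ)) := by
  have key : ((x : ℝ) + 1) ^ 3 * z < ((z : ℝ) + 1) ^ 3 * x := by
    exact_mod_cast Nat.succ_pow_three_mul_lt hx hxz
  have hfac : (0 : ℝ) < x.factorial * z.factorial := by positivity
  refine lt_of_pow_lt_pow_left₀ 2 (by positivity) ?_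
  simp only [mul_pow, Real.sq_sqrt (Nat.cast_nonneg _), Nat.factorial_succ]
  push_cast
  nlinarith [mul_lt_mul_of_pos_left key (pow_pos hfac 2)]

theorem Real.prod_factorial_mul_sqrt_prod {ι : Type*} (s : Finset ι) (b : ι → ℕ) :
    ((∏ l ∈ s, (b l).factorial : ℕ) : ℝ) * √(∏ l ∈ s, (b l : ℝ)) =
      ∏ l ∈ s, ((b l).factorial * √(b l : ℝ)) := by
  rw [Finset.prod_mul_distrib, Nat.cast_prod,
    Real.sqrt_prod s fun l _ => Nat.cast_nonneg (b l)]

/-- Adjustment step in Lemma 2: if `a j ≥ a i + 2`, moving one unit from part `j` to part `i`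
strictly decreases `f(a) = (∏ i, (a i)!) * √(∏ i, a i)`. -/
theorem countSketch_factorial_sqrt_adjustment_decreases
    (k : ℕ) (a : Fin k → ℕ) (hapos : ∀ i, 1 ≤ a i)
    (i j : Fin k) (hij : i ≠ j) (hgap : a i + 2 ≤ a j)
    (a' : Fin k → ℕ)
    (ha' : a' = Function.update (Function.update a i (a i + 1)) j (a j - 1)) :
    ((∏ l, Nat.factorial (a' l) : ℕ) : ℝ) * Real.sqrt (∏ l, (a' l : ℝ)) <
    ((∏ l, Nat.factorial (a l) : ℕ) : ℝ) * Real.sqrt (∏ l, (a l : ℝ)) := by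
  have hsplit (g : Fin k → ℝ) :
      ∏ l, g l = g i * g j * ∏ l ∈ (Finset.univ.erase i).erase j, g l := by
    rw [mul_assoc, Finset.mul_prod_erase _ _ (by simp [hij.symm]),
      Finset.mul_prod_erase _ _ (Finset.mem_univ i)]
  have hi : a' i = a i + 1 := by simp [ha', hij]
  have hj : a' j = a j - 1 := by simp [ha']
  have hrest : ∏ l ∈ (Finset.univ.erase i).erase j, ((a' l).factorial * √(a' l : ℝ)) =
      ∏ l ∈ (Finset.univ.erase i).erase j, ((a l).factorial * √(a l : ℝ)) := by
    refine Finset.prod_congr rfl fun l hl => ?_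
    simp only [Finset.mem_erase, Finset.mem_univ, and_true] at hl
    simp [ha', hl.1, hl.2]
  have hpos : 0 < ∏ l ∈ (Finset.univ.erase i).erase j, ((a l).factorial * √(a l : ℝ)) := by
    refine Finset.prod_pos fun l _ => ?_
    have : (0 : ℝ) < a l := by exact_mod_cast hapos l
    positivity
  rw [Real.prod_factorial_mul_sqrt_prod, Real.prod_factorial_mul_sqrt_prod, hsplit,
    hsplit fun l => (a l).factorial * √(a l : ℝ), hrest, hi, hj]
  have hlt := Real.factorial_mul_sqrt_balance_lt (hapos i) (z := a j - 1) (by omega)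
  rw [Nat.sub_add_cancel (hapos j)] at hlt
  exact mul_lt_mul_of_pos_right hlt hpos
end

section
/- Let k ≥ 2 and n ≥ k + 1 be integers. Then the sum, over all compositions (a_1, …, a_k) of n−1 into k positive parts, of (1/a_1 + 1/a_2 + ⋯ + 1/a_k) equals k · Σ_{j=1}^{n−k} (1/j) · C(n−2−j, k−2), where C(·,·) denotes the binomial coefficient. -/
open Finset in
/-- Deleting the `i`-th part identifies the compositions of `m` whose `i`-th part is `j` with the
compositions of `m - j` into one part fewer. -/
theorem card_filter_antidiagonalTuple_apply_eq (k m j : ℕ) (i : Fin (k + 1)) (hj : 1 ≤ j)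
    (hjm : j ≤ m) :
    #{a ∈ {a ∈ Nat.antidiagonalTuple (k + 1) m | ∀ i, 1 ≤ a i} | a i = j} =
      #{a ∈ Nat.antidiagonalTuple k (m - j) | ∀ i, 1 ≤ a i} := by
  refine card_nbij' (fun a => i.removeNth a) (fun b => i.insertNth j b) ?_ ?_ ?_ ?_
  · intro a ha
    simp only [coe_filter, mem_filter, Nat.mem_antidiagonalTuple, Set.mem_ofPred_eq] at ha ⊢
    obtain ⟨⟨hsum, hpos⟩, rfl⟩ := ha
    rw [Fin.sum_univ_succAbove _ i] at hsum
    exact ⟨by simp only [Fin.removeNth]; omega, fun l => hpos _⟩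
  · intro b hb
    simp only [coe_filter, mem_filter, Nat.mem_antidiagonalTuple, Set.mem_ofPred_eq] at hb ⊢
    obtain ⟨hsum, hpos⟩ := hb
    refine ⟨⟨?_, ?_⟩, by simp⟩
    · simp only [Fin.sum_univ_succAbove _ i, Fin.insertNth_apply_same,
        Fin.insertNth_apply_succAbove]
      omega
    · rw [Fin.forall_iff_succAbove i]
      simpa using ⟨hj, hpos⟩
  · intro a ha
    simp only [coe_filter, Set.mem_ofPred_eq] at ha
    simp [← ha.2]
  · intro b _
    simp

open Finset in
/-- A sum over compositions of a function of the `i`-th part, grouped by the value of that part. -/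
theorem sum_antidiagonalTuple_apply {M : Type*} [AddCommMonoid M] (k m : ℕ) (i : Fin (k + 2))
    (f : ℕ → M) :
    ∑ a ∈ Nat.antidiagonalTuple (k + 2) (m + 1) with ∀ i, 1 ≤ a i, f (a i) =
      ∑ j ∈ Icc 1 m,
        #{a ∈ Nat.antidiagonalTuple (k + 1) (m + 1 - j) | ∀ i, 1 ≤ a i} • f j := by
  rw [← sum_fiberwise_of_maps_to (t := Icc 1 m) (g := fun a => a i)]
  · refine sum_congr rfl fun j hj => ?_
    rw [mem_Icc] at hj
    rw [← card_filter_antidiagonalTuple_apply_eq (k + 1) (m + 1) j i hj.1 (by omega),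
      ← sum_const]
    exact sum_congr rfl fun a ha => by rw [(mem_filter.1 ha).2]
  · intro a ha
    simp only [mem_filter, Nat.mem_antidiagonalTuple] at ha
    obtain ⟨hsum, hpos⟩ := ha
    rw [Fin.sum_univ_succAbove _ i, Fin.sum_univ_succ] at hsum
    have := hpos i
    have := hpos (i.succAbove 0)
    rw [mem_Icc]
    omega

open Finset in
theorem sum_Icc_choose_sub (k m : ℕ) :
    ∑ j ∈ Icc 1 m, (m - j).choose k = m.choose (k + 1) := by
  rw [← Ico_add_one_right_eq_Icc, sum_Ico_eq_sum_range, Nat.add_sub_cancel]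
  induction m with
  | zero => simp
  | succ m ih =>
    rw [sum_range_succ', Nat.choose_succ_succ, ← ih, Nat.add_comm]
    refine congrArg₂ _ (by simp) (sum_congr rfl fun j _ => ?_)
    congr 1
    omega

open Finset in
/-- The number of compositions of `m + 1` into `k + 1` positive parts is `m.choose k`. -/
theorem card_filter_antidiagonalTuple_pos (k m : ℕ) :
    #{a ∈ Nat.antidiagonalTuple (k + 1) (m + 1) | ∀ i, 1 ≤ a i} = m.choose k := by
  induction k generalizing m with
  | zero => simp [Nat.antidiagonalTuple_one, filter_singleton]
  | succ k ih =>
    rw [card_eq_sum_ones, sum_antidiagonalTuple_apply k m 0 (fun _ => 1), ← sum_Icc_choose_sub]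
    refine sum_congr rfl fun j hj => ?_
    rw [mem_Icc] at hj
    rw [smul_eq_mul, mul_one, Nat.sub_add_comm hj.2, ih]

/-- Combinatorial identity from the proof of Theorem 1: the sum, over all compositions
`(a 1, …, a k)` of `n - 1` into `k` positive parts, of `∑ i, 1 / a i` equals
`k * ∑ j in [1, n-k], (1 / j) * C(n - 2 - j, k - 2)`. -/
theorem countSketch_reciprocal_sum_over_compositions
    (k n : ℕ) (hk : 2 ≤ k) (hn : k + 1 ≤ n) :
    ∑ a ∈ (Finset.Nat.antidiagonalTuple k (n - 1)).filter (fun a => ∀ i, 1 ≤ a i),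
        ∑ i, (1 : ℝ) / (a i : ℝ) =
      (k : ℝ) * ∑ j ∈ Finset.Icc 1 (n - k),
        ((1 : ℝ) / (j : ℝ)) * ((n - 2 - j).choose (k - 2) : ℝ) := by
  obtain ⟨k, rfl⟩ := Nat.exists_eq_add_of_le' hk
  obtain ⟨m, rfl⟩ := Nat.exists_eq_add_of_le' (show 2 ≤ n by omega)
  rw [Finset.sum_comm]
  have hpart (i : Fin (k + 2)) :
      ∑ a ∈ (Finset.Nat.antidiagonalTuple (k + 2) (m + 1)).filter (fun a => ∀ i, 1 ≤ a i),
          (1 : ℝ) / (a i : ℝ) =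
        ∑ j ∈ Finset.Icc 1 (m - k), (1 : ℝ) / (j : ℝ) * ((m - j).choose k : ℝ) := by
    rw [sum_antidiagonalTuple_apply k m i (fun j => (1 : ℝ) / (j : ℝ))]
    symm
    refine Finset.sum_subset_zero_on_sdiff (Finset.Icc_subset_Icc_right (by omega)) ?_ ?_
    · intro j hj
      simp only [Finset.mem_sdiff, Finset.mem_Icc] at hj
      rw [Nat.sub_add_comm hj.1.2, card_filter_antidiagonalTuple_pos,
        Nat.choose_eq_zero_of_lt (by omega), zero_smul]
    · intro j hj
      rw [Finset.mem_Icc] at hj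
      rw [Nat.sub_add_comm (by omega), card_filter_antidiagonalTuple_pos, nsmul_eq_mul, mul_comm]
  simp only [Nat.add_sub_add_right, Nat.add_sub_cancel, show m + 2 - 1 = m + 1 from rfl]
  rw [Finset.sum_congr rfl fun i _ => hpart i, Finset.sum_const, Finset.card_univ,
    Fintype.card_fin, nsmul_eq_mul]
end

section
/- Let k ≥ 2 and n ≥ k + 1 be integers. Then k · Σ_{j=1}^{n−k} (1/j) · C(n−2−j, k−2) ≤ C(n−2, k−1) · (k(k−1)/(n−2)) · (1 + ln(n−k)), where C(·,·) denotes the binomial coefficient and ln is the natural logarithm. -/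
/-- Central quantitative estimate in the proof of Theorem 1:
`k * ∑ j in [1, n-k], (1/j) * C(n-2-j, k-2)
  ≤ C(n-2, k-1) * (k * (k-1) / (n-2)) * (1 + ln (n-k))`. -/
theorem countSketch_main_estimate
    (k n : ℕ) (hk : 2 ≤ k) (hn : k + 1 ≤ n) :
    (k : ℝ) * ∑ j ∈ Finset.Icc 1 (n - k),
        ((1 : ℝ) / (j : ℝ)) * ((n - 2 - j).choose (k - 2) : ℝ) ≤
      ((n - 2).choose (k - 1) : ℝ) * ((k : ℝ) * ((k : ℝ) - 1) / ((n : ℝ) - 2)) *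
        (1 + Real.log ((n : ℝ) - (k : ℝ))) := by
  obtain ⟨a, rfl⟩ := Nat.exists_eq_add_of_le' hk
  obtain ⟨b, rfl⟩ := Nat.exists_eq_add_of_le' hn
  have hsub : b + (a + 2 + 1) - (a + 2) = b + 1 := by omega
  have hsub' : b + (a + 2 + 1) - 2 = a + b + 1 := by omega
  have hchoose : ((a + b + 1).choose (a + 1) : ℝ) * (a + 1) =
      (a + b + 1) * ((a + b).choose a : ℝ) := by
    exact_mod_cast (Nat.add_one_mul_choose_eq (a + b) a).symm
  have hharmonic : ∑ j ∈ Finset.Icc 1 (b + 1), (1 : ℝ) / (j : ℝ) ≤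
      1 + Real.log ((b : ℝ) + 1) := by
    have h := harmonic_le_one_add_log (b + 1)
    rw [harmonic_eq_sum_Icc] at h
    simpa using h
  have hsum : ∑ j ∈ Finset.Icc 1 (b + 1), (1 : ℝ) / (j : ℝ) * ((a + b + 1 - j).choose a : ℝ) ≤
      (∑ j ∈ Finset.Icc 1 (b + 1), (1 : ℝ) / (j : ℝ)) * ((a + b).choose a : ℝ) := by
    rw [Finset.sum_mul]
    refine Finset.sum_le_sum fun j hj => ?_
    have hj1 := (Finset.mem_Icc.mp hj).1
    gcongr
    omega
  have hcoeff : ((a + b + 1).choose (a + 1) : ℝ) *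
      (((a : ℝ) + 2) * ((a : ℝ) + 2 - 1) / ((b : ℝ) + (a + 2 + 1) - 2)) =
      (a + 2) * ((a + b).choose a : ℝ) := by
    have hpos : (b : ℝ) + (a + 2 + 1) - 2 ≠ 0 := by
      have : (0 : ℝ) < a + b + 1 := by positivity
      linarith
    rw [← mul_div_assoc, div_eq_iff hpos]
    linear_combination ((a : ℝ) + 2) * hchoose
  have hlog : (b : ℝ) + (a + 2 + 1) - (a + 2) = b + 1 := by ring
  rw [hsub, hsub', Nat.add_sub_cancel, show a + 2 - 1 = a + 1 by omega]
  push_cast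
  rw [hcoeff, hlog, mul_assoc]
  gcongr
  refine hsum.trans ?_
  rw [mul_comm]
  gcongr
end

section
/- Let E be a real inner product space, F : E → ℝ a convex differentiable function, x* ∈ E, and c > 0, M ≥ 0, D ≥ 0 real constants. Let i ≥ 1 be an integer and let x_1, x_2, …, x_{i+1} ∈ E satisfy x_{j+1} = x_j − (c/√j) · ∇F(x_j) for 1 ≤ j ≤ i. Assume ‖∇F(x_j)‖² ≤ M and ‖x_j − x*‖² ≤ D² for all 1 ≤ j ≤ i. Then, with x̄_i = (1/i) Σ_{j=1}^{i} x_j, it holds that F(x̄_i) − F(x*) ≤ D²/(2c√i) + (cM/(2i)) · Σ_{j=1}^{i} 1/√j. -/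
/-- A convex function lies above its tangent hyperplanes. -/
theorem ConvexOn.add_fderiv_sub_le {E : Type*} [NormedAddCommGroup E] [NormedSpace ℝ E]
    {s : Set E} {f : E → ℝ} {f' : E →L[ℝ] ℝ} {x y : E} (hf : ConvexOn ℝ s f)
    (hx : x ∈ s) (hy : y ∈ s) (hf' : HasFDerivAt f f' x) :
    f x + f' (y - x) ≤ f y := by
  have hg := hf.comp_affineMap (AffineMap.lineMap (k := ℝ) x y)
  have hd : HasDerivAt (f ∘ AffineMap.lineMap (k := ℝ) x y) (f' (y - x)) 0 :=
    HasFDerivAt.comp_hasDerivAt (0 : ℝ) (by simpa using hf') AffineMap.hasDerivAt_lineMap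
  have h := hg.le_slope_of_hasDerivAt (x := 0) (y := 1) (by simpa using hx) (by simpa using hy)
    one_pos hd
  simp only [slope_def_field, Function.comp_apply, AffineMap.lineMap_apply_zero,
    AffineMap.lineMap_apply_one, sub_zero, div_one] at h
  linarith

/-- The descent inequality for one gradient step of size `c / s`, weighted by `s`. -/
theorem ConvexOn.gradient_step_le {E : Type*} [NormedAddCommGroup E] [InnerProductSpace ℝ E]
    [CompleteSpace E] {F : E → ℝ} (hconv : ConvexOn ℝ Set.univ F) {x : E}
    (hdiff : DifferentiableAt ℝ F x) (z : E) {c s : ℝ} (hc : 0 ≤ c) (hs : 0 < s) :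
    2 * c * (F x - F z) ≤ s * ‖x - z‖ ^ 2 - s * ‖x - (c / s) • gradient F x - z‖ ^ 2 +
      c ^ 2 / s * ‖gradient F x‖ ^ 2 := by
  have htan := hconv.add_fderiv_sub_le (Set.mem_univ x) (Set.mem_univ z) hdiff.hasFDerivAt
  rw [← inner_gradient_left, ← neg_sub x z, inner_neg_right, real_inner_comm] at htan
  have hnorm : s * ‖x - (c / s) • gradient F x - z‖ ^ 2 =
      s * ‖x - z‖ ^ 2 - 2 * c * inner ℝ (x - z) (gradient F x) +
        c ^ 2 / s * ‖gradient F x‖ ^ 2 := by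
    rw [sub_right_comm, norm_sub_sq_real, inner_smul_right, norm_smul, mul_pow,
      Real.norm_eq_abs, sq_abs]
    field_simp
  rw [hnorm]
  nlinarith [mul_le_mul_of_nonneg_left htan hc]

/-- Jensen's inequality for the uniform average over a nonempty finite set. -/
theorem ConvexOn.map_finset_average_le {ι E : Type*} [AddCommGroup E] [Module ℝ E] {s : Set E}
    {f : E → ℝ} (hf : ConvexOn ℝ s f) {t : Finset ι} (ht : t.Nonempty) {p : ι → E}
    (hp : ∀ j ∈ t, p j ∈ s) :
    f ((1 / (t.card : ℝ)) • ∑ j ∈ t, p j) ≤ 1 / (t.card : ℝ) * ∑ j ∈ t, f (p j) := by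
  have hcard : (t.card : ℝ) ≠ 0 := by exact_mod_cast ht.card_pos.ne'
  have h := hf.map_sum_le (w := fun _ => 1 / (t.card : ℝ)) (fun _ _ => by positivity)
    (by simp [hcard]) hp
  simpa only [← Finset.smul_sum, ← Finset.mul_sum, smul_eq_mul] using h

/-- Deterministic core of Theorem 2 (convergence of DiffSketch with distributed SGD): for
gradient descent with step sizes `η_j = c / √j`, bounded gradients and bounded iterates, the
average iterate `x̄_i = (1/i) ∑_{j=1}^i x_j` satisfies
`F(x̄_i) - F(x*) ≤ D²/(2c√i) + (cM/(2i)) ∑_{j=1}^i 1/√j`. -/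
theorem sgd_average_iterate_convergence
    {E : Type*} [NormedAddCommGroup E] [InnerProductSpace ℝ E] [CompleteSpace E]
    (F : E → ℝ) (hconv : ConvexOn ℝ Set.univ F) (hdiff : Differentiable ℝ F)
    (xstar : E) (c M D : ℝ) (hc : 0 < c) (hM : 0 ≤ M) (hD : 0 ≤ D)
    (i : ℕ) (hi : 1 ≤ i) (x : ℕ → E)
    (hstep : ∀ j, 1 ≤ j → j ≤ i →
      x (j + 1) = x j - (c / Real.sqrt j) • gradient F (x j))
    (hgrad : ∀ j, 1 ≤ j → j ≤ i → ‖gradient F (x j)‖ ^ 2 ≤ M)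
    (hbound : ∀ j, 1 ≤ j → j ≤ i → ‖x j - xstar‖ ^ 2 ≤ D ^ 2)
    (xbar : E) (hxbar : xbar = ((1 : ℝ) / (i : ℝ)) • ∑ j ∈ Finset.Icc 1 i, x j) :
    F xbar - F xstar ≤
      D ^ 2 / (2 * c * Real.sqrt i) +
        (c * M / (2 * i)) * ∑ j ∈ Finset.Icc 1 i, 1 / Real.sqrt j := by
  have hsum : ∀ n ≤ i, 2 * c * ∑ j ∈ Finset.Icc 1 n, (F (x j) - F xstar) ≤
      Real.sqrt n * D ^ 2 - Real.sqrt n * ‖x (n + 1) - xstar‖ ^ 2 +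
        c ^ 2 * M * ∑ j ∈ Finset.Icc 1 n, 1 / Real.sqrt j := by
    intro n
    induction n with
    | zero => simp
    | succ n ih =>
      intro hn
      have h1 : 1 ≤ n + 1 := Nat.le_add_left 1 n
      have hs : 0 < Real.sqrt ((n + 1 : ℕ) : ℝ) := Real.sqrt_pos.2 (by positivity)
      have hle : Real.sqrt (n : ℝ) ≤ Real.sqrt ((n + 1 : ℕ) : ℝ) :=
        Real.sqrt_le_sqrt (by push_cast; linarith)
      have hdesc := hconv.gradient_step_le (hdiff (x (n + 1))) xstar hc.le hs
      rw [← hstep (n + 1) h1 hn] at hdesc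
      have hG := mul_le_mul_of_nonneg_left (hgrad (n + 1) h1 hn)
        (by positivity : 0 ≤ c ^ 2 / Real.sqrt ((n + 1 : ℕ) : ℝ))
      have hB := mul_le_mul_of_nonneg_left (hbound (n + 1) h1 hn) (sub_nonneg.2 hle)
      have hM' : c ^ 2 * M * (1 / Real.sqrt ((n + 1 : ℕ) : ℝ)) =
          c ^ 2 / Real.sqrt ((n + 1 : ℕ) : ℝ) * M := by ring
      rw [Finset.sum_Icc_succ_top h1, Finset.sum_Icc_succ_top h1, mul_add, mul_add, hM']
      linarith [ih (Nat.le_of_succ_le hn)]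
  have hi0 : (0 : ℝ) < i := by exact_mod_cast hi
  have hs0 : 0 < Real.sqrt i := Real.sqrt_pos.2 hi0
  have hJ := hconv.map_finset_average_le (Finset.nonempty_Icc.2 hi) (p := x) fun _ _ => Set.mem_univ _
  rw [Nat.card_Icc, Nat.add_sub_cancel, ← hxbar] at hJ
  have htotal := hsum i le_rfl
  rw [Finset.sum_sub_distrib, Finset.sum_const, Nat.card_Icc, Nat.add_sub_cancel,
    nsmul_eq_mul] at htotal
  set S := ∑ j ∈ Finset.Icc 1 i, 1 / Real.sqrt j
  set T := ∑ j ∈ Finset.Icc 1 i, F (x j)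
  have hT : 2 * c * (T - i * F xstar) ≤ Real.sqrt i * D ^ 2 + c ^ 2 * M * S := by
    have : 0 ≤ Real.sqrt i * ‖x (i + 1) - xstar‖ ^ 2 := by positivity
    linarith
  calc F xbar - F xstar ≤ 1 / (i : ℝ) * T - F xstar := by linarith
    _ = 2 * c * (T - i * F xstar) / (2 * c * i) := by field_simp
    _ ≤ (Real.sqrt i * D ^ 2 + c ^ 2 * M * S) / (2 * c * i) := by gcongr
    _ = D ^ 2 / (2 * c * Real.sqrt i) + (c * M / (2 * i)) * S := by
      have hsq : Real.sqrt i * D ^ 2 / (2 * c * i) = D ^ 2 / (2 * c * Real.sqrt i) := by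
        rw [div_eq_div_iff (by positivity) (by positivity)]
        linear_combination 2 * c * D ^ 2 * Real.mul_self_sqrt hi0.le
      rw [add_div, hsq]
      field_simp
end
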